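/- Let l_1, …, l_n ≥ 1 be integers, μ = l_1⋯l_n, and ξ_ν = exp(2π√−1/l_ν). In the polynomial ring ℂ[A_1,…,A_n] define P := Π ( Σ_{ν=1}^n l_ν (ξ_ν^{c_ν} − ξ_ν^{d_ν}) A_ν^{l_ν+1} ), where the product ranges over all ordered pairs (c,d) of multiindices in I with c ≠ d. Then P ≠ 0, and for each ν the largest integer k such that A_ν^k divides P equals (l_ν² − 1)·μ. (In the unfolding parameters α_ν = A_ν^{l_ν} this says that the Hefez–Lazzeri bifurcation polynomial vanishes to order exactly (l_ν² − 1)μ/l_ν along the coordinate hyperplane α_ν = 0.) -/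

import Mathlib

namespace Stmt5

open MvPolynomial

/-- The primitive `l_ν`-th root of unity `ξ_ν = exp(2π√−1 / l_ν)`. -/
noncomputable def ξ (n : ℕ) (l : Fin n → ℕ) (ν : Fin n) : ℂ :=
  Complex.exp (2 * Real.pi * Complex.I / (l ν : ℂ))

/-- The Hefez–Lazzeri polynomial (in the root variables `A_ν`):
`P = Π_{c ≠ d} ( Σ_ν l_ν (ξ_ν^{c_ν} − ξ_ν^{d_ν}) A_ν^{l_ν+1} )`, the product over all
ordered pairs `(c, d)` of distinct multiindices. -/
noncomputable def P (n : ℕ) (l : Fin n → ℕ) : MvPolynomial (Fin n) ℂ :=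
  ∏ p ∈ Finset.univ.filter
      (fun p : ((ν : Fin n) → Fin (l ν)) × ((ν : Fin n) → Fin (l ν)) => p.1 ≠ p.2),
    ∑ ν, C ((l ν : ℂ) * (ξ n l ν ^ (p.1 ν : ℕ) - ξ n l ν ^ (p.2 ν : ℕ))) * X ν ^ (l ν + 1)

/-- Evaluating a diagonal sum of powers at a coordinate vector reads off a coefficient. -/
theorem eval_single_sum_C_mul_X_pow {σ R : Type*} [Fintype σ] [DecidableEq σ] [CommRing R]
    (a : σ → R) (e : σ → ℕ) (he : ∀ j, e j ≠ 0) (i : σ) :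
    eval (Pi.single i 1) (∑ j, C (a j) * X j ^ e j) = a i := by
  rw [map_sum, Finset.sum_eq_single i]
  · simp
  · intro j _ hj
    simp [hj, he j]
  · simp

theorem sum_C_mul_X_pow_ne_zero {σ R : Type*} [Fintype σ] [CommRing R]
    (a : σ → R) (e : σ → ℕ) (he : ∀ j, e j ≠ 0) (ha : a ≠ 0) :
    (∑ j, C (a j) * X j ^ e j : MvPolynomial σ R) ≠ 0 := by
  classical
  obtain ⟨i, hi⟩ := Function.ne_iff.1 ha
  intro h
  apply hi
  simpa [h] using (eval_single_sum_C_mul_X_pow a e he i).symm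

open Classical in
theorem emultiplicity_X_sum_C_mul_X_pow {σ R : Type*} [Fintype σ] [CommRing R] [IsDomain R]
    (a : σ → R) (e : σ → ℕ) (he : ∀ j, e j ≠ 0) (ha : a ≠ 0) (i : σ) :
    emultiplicity (X i) (∑ j, C (a j) * X j ^ e j : MvPolynomial σ R) =
      ((if ∀ j, j ≠ i → a j = 0 then e i else 0 : ℕ) : ℕ∞) := by
  split_ifs with h
  · have hi : a i ≠ 0 := by
      intro hi
      apply ha
      funext j
      by_cases hj : j = i
      · simpa [hj] using hi
      · exact h j hj
    rw [Finset.sum_eq_single i (fun j _ hj => by simp [h j hj]) (by simp),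
      emultiplicity_mul (X_prime (i := i)), emultiplicity_pow_self (X_ne_zero i) X_prime.not_isUnit,
      emultiplicity_eq_zero.2, zero_add]
    rintro ⟨q, hq⟩
    apply hi
    simpa using congrArg (eval 0) hq
  · push Not at h
    obtain ⟨j, hj, hja⟩ := h
    rw [Nat.cast_zero, emultiplicity_eq_zero]
    rintro ⟨q, hq⟩
    apply hja
    rw [← eval_single_sum_C_mul_X_pow a e he j, hq]
    simp [hj.symm]

theorem card_ne_and_eq_off {ι : Type*} [Fintype ι] [DecidableEq ι] {α : ι → Type*}
    [∀ i, Fintype (α i)] [∀ i, DecidableEq (α i)] (c : ∀ i, α i) (i : ι) :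
    (Finset.univ.filter fun d : ∀ i, α i => c ≠ d ∧ ∀ j, j ≠ i → c j = d j).card =
      Fintype.card (α i) - 1 := by
  have h : (Finset.univ.filter fun d : ∀ i, α i => c ≠ d ∧ ∀ j, j ≠ i → c j = d j) =
      (Finset.univ.erase (c i)).image (Function.update c i) := by
    ext d
    simp only [Finset.mem_filter, Finset.mem_univ, true_and, Finset.mem_image, Finset.mem_erase,
      and_true]
    constructor
    · rintro ⟨hne, hd⟩
      have hup : Function.update c i (d i) = d := by
        funext j
        by_cases hj : j = i
        · subst hj; simp
        · simp [hj, hd j hj]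
      refine ⟨d i, fun hi => hne ?_, hup⟩
      rw [← hup, hi, Function.update_eq_self]
    · rintro ⟨t, ht, rfl⟩
      refine ⟨fun hc => ht ?_, fun j hj => by simp [hj]⟩
      simpa using (congrFun hc i).symm
  rw [h, Finset.card_image_of_injective _ (Function.update_injective c i),
    Finset.card_erase_of_mem (Finset.mem_univ _), Finset.card_univ]

theorem coeff_eq_zero_iff {n : ℕ} {l : Fin n → ℕ} (ν : Fin n) (s t : Fin (l ν)) :
    (l ν : ℂ) * (ξ n l ν ^ (s : ℕ) - ξ n l ν ^ (t : ℕ)) = 0 ↔ s = t := by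
  have hl : l ν ≠ 0 := (Fin.pos s).ne'
  constructor
  · intro h
    have h' := (mul_eq_zero.1 h).resolve_left (Nat.cast_ne_zero.2 hl)
    exact Fin.ext ((Complex.isPrimitiveRoot_exp (l ν) hl).pow_inj s.2 t.2 (sub_eq_zero.1 h'))
  · rintro rfl
    simp

theorem coeff_ne_zero {n : ℕ} {l : Fin n → ℕ} {c d : (ν : Fin n) → Fin (l ν)} (h : c ≠ d) :
    (fun ν => (l ν : ℂ) * (ξ n l ν ^ (c ν : ℕ) - ξ n l ν ^ (d ν : ℕ))) ≠ 0 := by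
  intro h0
  exact h (funext fun ν => (coeff_eq_zero_iff ν _ _).1 (congrFun h0 ν))

theorem P_ne_zero (n : ℕ) (l : Fin n → ℕ) : P n l ≠ 0 := by
  refine Finset.prod_ne_zero_iff.2 fun p hp => ?_
  exact sum_C_mul_X_pow_ne_zero _ (fun ν => l ν + 1) (fun _ => Nat.succ_ne_zero _)
    (coeff_ne_zero (Finset.mem_filter.1 hp).2)

theorem emultiplicity_X_P (n : ℕ) (l : Fin n → ℕ) (ν : Fin n) :
    emultiplicity (X ν) (P n l) = (((l ν ^ 2 - 1) * ∏ μ, l μ : ℕ) : ℕ∞) := by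
  classical
  rw [P, Finset.emultiplicity_prod X_prime, Finset.sum_congr rfl fun p hp =>
    emultiplicity_X_sum_C_mul_X_pow _ (fun ν => l ν + 1) (fun _ => Nat.succ_ne_zero _)
      (coeff_ne_zero (Finset.mem_filter.1 hp).2) ν, ← Nat.cast_sum]
  simp only [coeff_eq_zero_iff]
  congr 1
  rw [← Finset.sum_filter, Finset.filter_filter, Finset.sum_filter, Fintype.sum_prod_type]
  trans ∑ _c : (μ : Fin n) → Fin (l μ), (l ν - 1) * (l ν + 1)
  · refine Finset.sum_congr rfl fun c _ => ?_
    rw [← Finset.sum_filter, Finset.sum_const, smul_eq_mul]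
    congr 1
    convert card_ne_and_eq_off c ν
    exact (Fintype.card_fin _).symm
  · rw [Finset.sum_const, Finset.card_univ, Fintype.card_pi, smul_eq_mul]
    simp only [Fintype.card_fin]
    rw [← one_pow 2, Nat.sq_sub_sq, one_pow]
    ring

/-- `P ≠ 0`, and for each `ν` the largest `k` with `A_ν^k ∣ P` is
`(l_ν² − 1)·μ`, where `μ = l_1 ⋯ l_n`. -/
theorem statement5 (n : ℕ) (l : Fin n → ℕ) (hl : ∀ ν, 1 ≤ l ν) :
    P n l ≠ 0 ∧
    ∀ ν : Fin n, IsGreatest {k : ℕ | X ν ^ k ∣ P n l} ((l ν ^ 2 - 1) * ∏ μ, l μ) := by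
  refine ⟨P_ne_zero n l, fun ν => ⟨?_, fun k hk => ?_⟩⟩
  · exact pow_dvd_iff_le_emultiplicity.2 (emultiplicity_X_P n l ν).ge
  · exact Nat.cast_le.1 ((pow_dvd_iff_le_emultiplicity.1 hk).trans (emultiplicity_X_P n l ν).le)

end Stmt5
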